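/- arXiv:2412.20377 — 2 statements merged into one kernel-verified Lean document; each statement's English description precedes it below -/
import Mathlib

section
/- Fairness generalization bound with repeated experiments: for any 0 < δ < 1, with probability at least 1 − δ over the draw of all samples, max_{a_i, a_j ∈ A} |E_{D_{a_i}}[g] − E_{D_{a_j}}[g]| ≤ max_{a_i, a_j ∈ A} |(1/n)∑_{k=1}^n R̂_{a_i}^{(k)} − (1/n)∑_{k=1}^n R̂_{a_j}^{(k)}| + 2·√(log(4·|A|/δ)/(2·n·m)), where R̂_a^{(k)} = (1/m)∑_{l=1}^m g(Z_l^{a,(k)}) is the empirical risk on the k-th sample of group a. -/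
open MeasureTheory ProbabilityTheory

/-- A sub-Gaussian bound transfers along a measure-preserving map. -/
theorem hasSubgaussianMGF_comp {X Y : Type*} [MeasurableSpace X] [MeasurableSpace Y]
    {μ : Measure X} {ν : Measure Y} {f : Y → ℝ} {c : NNReal} {T : X → Y}
    (hT : MeasurePreserving T μ ν) (h : HasSubgaussianMGF f c ν) :
    HasSubgaussianMGF (fun x => f (T x)) c μ := by
  rw [← hT.map_eq] at h
  exact h.of_map hT.measurable.aemeasurable

/-- The sum of i.i.d. copies of a sub-Gaussian variable is sub-Gaussian. -/
theorem hasSubgaussianMGF_sum_pi {X ι : Type*} [MeasurableSpace X] [Fintype ι]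
    {μ : Measure X} [IsProbabilityMeasure μ] {f : X → ℝ} {c : NNReal}
    (h : HasSubgaussianMGF f c μ) :
    HasSubgaussianMGF (fun ω : ι → X => ∑ i, f (ω i)) (Fintype.card ι * c)
      (Measure.pi fun _ : ι => μ) := by
  have hind : iIndepFun (fun i (ω : ι → X) => f (ω i)) (Measure.pi fun _ : ι => μ) :=
    iIndepFun_pi fun _ => h.aemeasurable
  have hs := HasSubgaussianMGF.sum_of_iIndepFun hind (c := fun _ => c) (s := Finset.univ)
    fun i _ => hasSubgaussianMGF_comp (measurePreserving_eval (fun _ : ι => μ) i) h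
  simpa using hs

/-- Two-sided sub-Gaussian tail bound. -/
theorem HasSubgaussianMGF.measureReal_abs_ge_le {X : Type*} [MeasurableSpace X]
    {μ : Measure X} [IsFiniteMeasure μ] {f : X → ℝ} {c : NNReal}
    (h : HasSubgaussianMGF f c μ) {ε : ℝ} (hε : 0 ≤ ε) :
    μ.real {x | ε ≤ |f x|} ≤ 2 * Real.exp (-ε ^ 2 / (2 * c)) := by
  have h1 := h.measure_ge_le hε
  have h2 := h.neg.measure_ge_le hε
  have hsub : {x | ε ≤ |f x|} ⊆ {x | ε ≤ f x} ∪ {x | ε ≤ (-f) x} :=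
    fun x (hx : ε ≤ |f x|) => show ε ≤ f x ∨ ε ≤ -f x from le_abs.mp hx
  calc μ.real {x | ε ≤ |f x|} ≤ μ.real ({x | ε ≤ f x} ∪ {x | ε ≤ (-f) x}) := measureReal_mono hsub
    _ ≤ _ := measureReal_union_le _ _
    _ ≤ _ := by linarith

/-- Fairness generalization bound with repeated experiments. -/
theorem stmt_3
    {Z : Type*} [MeasurableSpace Z]
    {A : Type*} [Fintype A] [Nonempty A]
    (D : A → Measure Z) [∀ a, IsProbabilityMeasure (D a)]
    (n m : ℕ) (hn : 1 ≤ n) (hm : 1 ≤ m)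
    (g : Z → ℝ) (hg : Measurable g) (hgb : ∀ z, g z ∈ Set.Icc (0 : ℝ) 1)
    (δ : ℝ) (hδ : 0 < δ) (hδ1 : δ < 1) :
    ENNReal.ofReal (1 - δ) ≤
      (Measure.pi fun a : A => Measure.pi fun _ : Fin n => Measure.pi fun _ : Fin m => D a)
        {ω | ∀ i j : A,
          |(∫ z, g z ∂(D i)) - ∫ z, g z ∂(D j)| ≤
            (Finset.univ.sup' Finset.univ_nonempty fun p : A × A =>
              |(1 / (n : ℝ)) * ∑ k, ((1 / (m : ℝ)) * ∑ l, g (ω p.1 k l)) -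
                (1 / (n : ℝ)) * ∑ k, ((1 / (m : ℝ)) * ∑ l, g (ω p.2 k l))|) +
              2 * Real.sqrt (Real.log (4 * (Fintype.card A : ℝ) / δ) / (2 * (n * m)))} := by
  set P := Measure.pi fun a : A => Measure.pi fun _ : Fin n => Measure.pi fun _ : Fin m => D a
  set E : A → ℝ := fun a => ∫ z, g z ∂(D a)
  set R : A → (A → Fin n → Fin m → Z) → ℝ := fun a ω =>
    (1 / (n : ℝ)) * ∑ k, ((1 / (m : ℝ)) * ∑ l, g (ω a k l)) with hR
  set ε := Real.sqrt (Real.log (4 * (Fintype.card A : ℝ) / δ) / (2 * (n * m))) with hεdef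
  have hn0 : (0 : ℝ) < n := by exact_mod_cast hn
  have hm0 : (0 : ℝ) < m := by exact_mod_cast hm
  have hnm : (0 : ℝ) < n * m := mul_pos hn0 hm0
  have hA1 : (1 : ℝ) ≤ Fintype.card A := by exact_mod_cast Fintype.card_pos
  have hε : 0 ≤ ε := Real.sqrt_nonneg _
  have hεsq : ε ^ 2 = Real.log (4 * (Fintype.card A : ℝ) / δ) / (2 * (n * m)) := by
    refine Real.sq_sqrt (div_nonneg (Real.log_nonneg ?_) (by positivity))
    rw [le_div_iff₀ hδ]
    linarith
  have htail (a : A) : P.real {ω | ε ≤ |R a ω - E a|} ≤ δ / (2 * Fintype.card A) := by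
    have hsub := hasSubgaussianMGF_comp
      (measurePreserving_eval
        (fun a : A => Measure.pi fun _ : Fin n => Measure.pi fun _ : Fin m => D a) a)
      (hasSubgaussianMGF_sum_pi (ι := Fin n) (hasSubgaussianMGF_sum_pi (ι := Fin m)
        (hasSubgaussianMGF_of_mem_Icc (μ := D a) hg.aemeasurable (ae_of_all _ hgb))))
    have hb := HasSubgaussianMGF.measureReal_abs_ge_le hsub (ε := n * m * ε) (by positivity)
    have hset : {ω : A → Fin n → Fin m → Z | ε ≤ |R a ω - E a|} =
        {ω | n * m * ε ≤ |∑ k, ∑ l, (g (ω a k l) - E a)|} := by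
      ext ω
      have hsum : ∑ k, ∑ l, (g (ω a k l) - E a) = n * m * (R a ω - E a) := by
        simp only [hR, Finset.sum_sub_distrib, ← Finset.mul_sum,
          Finset.sum_const, Finset.card_univ, Fintype.card_fin, nsmul_eq_mul]
        field_simp
      rw [Set.mem_ofPred_eq, Set.mem_ofPred_eq, hsum, abs_mul, abs_of_pos hnm]
      exact (mul_le_mul_iff_right₀ hnm).symm
    rw [hset]
    refine hb.trans_eq ?_
    have hexp : -(n * m * ε) ^ 2 / (2 * ((Fintype.card (Fin n) * (Fintype.card (Fin m) *
        (‖(1 : ℝ) - 0‖₊ / 2) ^ 2) : NNReal) : ℝ)) = -Real.log (4 * (Fintype.card A : ℝ) / δ) := by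
      rw [mul_pow, hεsq]
      simp only [Fintype.card_fin, sub_zero, nnnorm_one, NNReal.coe_mul, NNReal.coe_natCast,
        NNReal.coe_pow, NNReal.coe_div, NNReal.coe_one, NNReal.coe_ofNat]
      field_simp
    rw [hexp, Real.exp_neg, Real.exp_log (by positivity)]
    field_simp
    norm_num
  set S := {ω : A → Fin n → Fin m → Z | ∀ i j : A, |E i - E j| ≤
    (Finset.univ.sup' Finset.univ_nonempty fun p : A × A => |R p.1 ω - R p.2 ω|) + 2 * ε}
  change _ ≤ P S
  have hcompl : Sᶜ ⊆ ⋃ a, {ω | ε ≤ |R a ω - E a|} := by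
    intro ω hω
    by_contra hcon
    simp only [Set.mem_iUnion, Set.mem_ofPred_eq, not_exists, not_le] at hcon
    refine hω fun i j => ?_
    have hmax := Finset.le_sup' (fun p : A × A => |R p.1 ω - R p.2 ω|) (Finset.mem_univ (i, j))
    have hi := abs_lt.mp (hcon i)
    have hj := abs_lt.mp (hcon j)
    refine le_trans ?_ (add_le_add_left hmax _)
    obtain ⟨hlow, hup⟩ := abs_le.mp (le_refl |R i ω - R j ω|)
    exact abs_le.mpr ⟨by linarith, by linarith⟩
  have hbad : P.real Sᶜ ≤ δ :=
    calc P.real Sᶜ ≤ P.real (⋃ a, {ω | ε ≤ |R a ω - E a|}) := measureReal_mono hcompl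
      _ ≤ ∑ a, P.real {ω | ε ≤ |R a ω - E a|} := measureReal_iUnion_fintype_le _
      _ ≤ ∑ _a : A, δ / (2 * Fintype.card A) := Finset.sum_le_sum fun a _ => htail a
      _ = δ / 2 := by
        rw [Finset.sum_const, Finset.card_univ, nsmul_eq_mul]
        field_simp
      _ ≤ δ := by linarith
  have htotal : 1 ≤ P.real S + P.real Sᶜ := by
    have := measureReal_union_le (μ := P) S Sᶜ
    rwa [Set.union_compl_self, probReal_univ] at this
  rw [ENNReal.ofReal_le_iff_le_toReal (measure_ne_top _ _)]
  change 1 - δ ≤ P.real S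
  linarith
end

section
/- Learning bound via consistency (realizable PAC bound): the probability, over an i.i.d. sample S = ((x_1,y_1),…,(x_m,y_m)) drawn from D, that there exists some f ∈ F' which is consistent on S (i.e., f(x_k) = y_k for all k = 1,…,m) is at most |F'|·(1 − ε)^m ≤ |F'|·e^{−mε}; consequently, if m ≥ (1/ε)·(log|F'| + log(1/δ)) for some 0 < δ < 1, then this probability is at most δ. -/
open MeasureTheory ProbabilityTheory

/-- A predictor with error at least `ε` is consistent with `m` i.i.d. samples with probability
at most `(1 - ε) ^ m`. -/
theorem measure_pi_consistent_le
    {X : Type*} [MeasurableSpace X]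
    {Y : Type*} [MeasurableSpace Y] [MeasurableSingletonClass Y] [Countable Y]
    (D : Measure (X × Y)) [IsProbabilityMeasure D] (m : ℕ) {ε : ℝ} (hε : 0 ≤ ε) (hε1 : ε ≤ 1)
    {f : X → Y} (hf : Measurable f)
    (herr : ENNReal.ofReal ε ≤ D {p : X × Y | f p.1 ≠ p.2}) :
    (Measure.pi fun _ : Fin m => D) {S : Fin m → X × Y | ∀ k, f (S k).1 = (S k).2} ≤
      ENNReal.ofReal ((1 - ε) ^ m) := by
  have hA : MeasurableSet {p : X × Y | f p.1 = p.2} :=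
    measurableSet_eq_fun (hf.comp measurable_fst) measurable_snd
  have hDA : D {p : X × Y | f p.1 = p.2} ≤ ENNReal.ofReal (1 - ε) := by
    rw [ENNReal.ofReal_sub _ hε, ENNReal.ofReal_one,
      ← compl_compl {p : X × Y | f p.1 = p.2}, prob_compl_eq_one_sub hA.compl]
    exact tsub_le_tsub_left herr 1
  have hpi : {S : Fin m → X × Y | ∀ k, f (S k).1 = (S k).2} =
      Set.univ.pi fun _ => {p : X × Y | f p.1 = p.2} := by
    ext S
    simp
  rw [hpi, Measure.pi_pi, Finset.prod_const, Finset.card_univ, Fintype.card_fin,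
    ENNReal.ofReal_pow (sub_nonneg.2 hε1)]
  gcongr

/-- Learning bound via consistency (realizable PAC bound). -/
theorem stmt_4
    {X : Type*} [MeasurableSpace X]
    {Y : Type*} [MeasurableSpace Y] [MeasurableSingletonClass Y] [Countable Y]
    (D : Measure (X × Y)) [IsProbabilityMeasure D]
    (m : ℕ) (hm : 1 ≤ m)
    (ε : ℝ) (hε : 0 < ε) (hε1 : ε ≤ 1)
    (F' : Finset (X → Y)) (hFmeas : ∀ f ∈ F', Measurable f)
    (hFerr : ∀ f ∈ F', ENNReal.ofReal ε ≤ D {p : X × Y | f p.1 ≠ p.2}) :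
    (Measure.pi fun _ : Fin m => D)
        {S : Fin m → X × Y | ∃ f ∈ F', ∀ k, f (S k).1 = (S k).2} ≤
      ENNReal.ofReal ((F'.card : ℝ) * (1 - ε) ^ m) ∧
    ENNReal.ofReal ((F'.card : ℝ) * (1 - ε) ^ m) ≤
      ENNReal.ofReal ((F'.card : ℝ) * Real.exp (-(m * ε))) ∧
    ∀ δ : ℝ, 0 < δ → δ < 1 →
      (m : ℝ) ≥ (1 / ε) * (Real.log (F'.card : ℝ) + Real.log (1 / δ)) →
      (Measure.pi fun _ : Fin m => D)
          {S : Fin m → X × Y | ∃ f ∈ F', ∀ k, f (S k).1 = (S k).2} ≤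
        ENNReal.ofReal δ := by
  have hunion : (Measure.pi fun _ : Fin m => D)
      {S : Fin m → X × Y | ∃ f ∈ F', ∀ k, f (S k).1 = (S k).2} ≤
        ENNReal.ofReal ((F'.card : ℝ) * (1 - ε) ^ m) := by
    have hset : {S : Fin m → X × Y | ∃ f ∈ F', ∀ k, f (S k).1 = (S k).2} =
        ⋃ f ∈ F', {S : Fin m → X × Y | ∀ k, f (S k).1 = (S k).2} := by
      ext S
      simp
    rw [hset]
    refine (measure_biUnion_finset_le F' _).trans ((Finset.sum_le_sum fun f hf =>
      measure_pi_consistent_le D m hε.le hε1 (hFmeas f hf) (hFerr f hf)).trans_eq ?_)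
    rw [Finset.sum_const, nsmul_eq_mul, ENNReal.ofReal_mul (Nat.cast_nonneg _),
      ENNReal.ofReal_natCast]
  have hexp : (F'.card : ℝ) * (1 - ε) ^ m ≤ (F'.card : ℝ) * Real.exp (-(m * ε)) := by
    rw [← mul_neg, Real.exp_nat_mul]
    have h0 : 0 ≤ 1 - ε := sub_nonneg.2 hε1
    gcongr
    exact Real.one_sub_le_exp_neg ε
  refine ⟨hunion, ENNReal.ofReal_le_ofReal hexp, fun δ hδ _ hm' => ?_⟩
  refine hunion.trans (ENNReal.ofReal_le_ofReal (hexp.trans ?_))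
  rcases F'.card.eq_zero_or_pos with hc | hc
  · simpa [hc] using hδ.le
  · have hc' : (0 : ℝ) < F'.card := Nat.cast_pos.2 hc
    rw [ge_iff_le, one_div_mul_eq_div, div_le_iff₀ hε, one_div, Real.log_inv] at hm'
    calc (F'.card : ℝ) * Real.exp (-(m * ε))
        = Real.exp (Real.log F'.card - m * ε) := by
          rw [sub_eq_add_neg, Real.exp_add, Real.exp_log hc']
      _ ≤ Real.exp (Real.log δ) := Real.exp_le_exp.2 (by linarith)
      _ = δ := Real.exp_log hδ
end
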